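/- Let T = [A,B,C]_R with A ∈ F^{I×R}, B ∈ F^{J×R}, C ∈ F^{K×R}, and set m_C := R − r_C + 2. Assume: (i) max(min(k_A, k_B − 1), min(k_A − 1, k_B)) + k_C ≥ R + 1; (ii) condition (W m_C) holds for the triple (A,B,C); (iii) the Khatri-Rao product A⊙B has full column rank. Then r_T = R and the CPD of T is unique. -/

import Mathlib

open scoped Matrix
open MeasureTheory

variable {F : Type*} [RCLike F]

/-- The k-rank of a matrix: the largest `k` such that every subset of `k` columns is
linearly independent. -/
noncomputable def krank {I R : ℕ} (A : Matrix (Fin I) (Fin R) F) : ℕ :=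
  sSup {k | k ≤ R ∧ ∀ s : Finset (Fin R), s.card = k →
    LinearIndependent F (fun r : {x // x ∈ s} => A.transpose r.1)}

/-- The tensor `[A,B,C]_R` with entries `t_{ijk} = ∑ r, a_r(i) b_r(j) c_r(k)`. -/
def pdTensor {I J K R : ℕ} (A : Matrix (Fin I) (Fin R) F) (B : Matrix (Fin J) (Fin R) F)
    (C : Matrix (Fin K) (Fin R) F) : Fin I → Fin J → Fin K → F :=
  fun i j k => ∑ r, A i r * B j r * C k r

/-- `T = [A,B,C]_R` is a polyadic decomposition of `T` (columns are required nonzero). -/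
def IsPD {I J K R : ℕ} (T : Fin I → Fin J → Fin K → F) (A : Matrix (Fin I) (Fin R) F)
    (B : Matrix (Fin J) (Fin R) F) (C : Matrix (Fin K) (Fin R) F) : Prop :=
  (∀ r, A.transpose r ≠ 0) ∧ (∀ r, B.transpose r ≠ 0) ∧ (∀ r, C.transpose r ≠ 0) ∧
    T = pdTensor A B C

/-- The rank of a tensor: the minimal number of rank-1 terms in a PD. -/
noncomputable def tensorRank {I J K : ℕ} (T : Fin I → Fin J → Fin K → F) : ℕ :=
  sInf {R | ∃ A : Matrix (Fin I) (Fin R) F, ∃ B : Matrix (Fin J) (Fin R) F,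
    ∃ C : Matrix (Fin K) (Fin R) F, IsPD T A B C}

/-- The CPD of `T` (with `R` terms) is (essentially) unique: any two PDs with `R` terms
coincide up to permutation and scaling. -/
def CPDUnique {I J K : ℕ} (T : Fin I → Fin J → Fin K → F) (R : ℕ) : Prop :=
  ∀ (A A' : Matrix (Fin I) (Fin R) F) (B B' : Matrix (Fin J) (Fin R) F)
    (C C' : Matrix (Fin K) (Fin R) F), IsPD T A B C → IsPD T A' B' C' →
    ∃ σ : Equiv.Perm (Fin R), ∃ la lb lc : Fin R → F,
      (∀ r, la r * lb r * lc r = 1) ∧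
      (∀ i r, A' i r = A i (σ r) * la r) ∧
      (∀ j r, B' j r = B j (σ r) * lb r) ∧
      (∀ k r, C' k r = C k (σ r) * lc r)

/-- The third factor matrix of `T` (with `R` terms) is (essentially) unique. -/
def ThirdFactorUnique {I J K : ℕ} (T : Fin I → Fin J → Fin K → F) (R : ℕ) : Prop :=
  ∀ (A A' : Matrix (Fin I) (Fin R) F) (B B' : Matrix (Fin J) (Fin R) F)
    (C C' : Matrix (Fin K) (Fin R) F), IsPD T A B C → IsPD T A' B' C' →
    ∃ σ : Equiv.Perm (Fin R), ∃ lc : Fin R → F, (∀ r, lc r ≠ 0) ∧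
      (∀ k r, C' k r = C k (σ r) * lc r)

/-- The `m`-th compound matrix: the matrix of all `m × m` minors of `A`, with rows and
columns indexed by the `m`-element index subsets (taken in increasing order). -/
noncomputable def compound {I R : ℕ} (m : ℕ) (A : Matrix (Fin I) (Fin R) F) :
    Matrix {s : Finset (Fin I) // s.card = m} {t : Finset (Fin R) // t.card = m} F :=
  fun s t => Matrix.det (Matrix.of fun i j : Fin m =>
    A (s.1.orderIsoOfFin s.2 i).1 (t.1.orderIsoOfFin t.2 j).1)

/-- Khatri–Rao (column-wise Kronecker) product. -/
def khatriRao {α β γ : Type*} (A : Matrix α γ F) (B : Matrix β γ F) : Matrix (α × β) γ F :=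
  fun p c => A p.1 c * B p.2 c

/-- A matrix has full column rank iff its columns are linearly independent. -/
def FullColRank {α γ : Type*} (M : Matrix α γ F) : Prop :=
  LinearIndependent F M.transpose

/-- The vector `d̂^(m)` of all products `d_{i₁} ⋯ d_{i_m}`, `i₁ < ⋯ < i_m`. -/
def hatVec {R : ℕ} (m : ℕ) (d : Fin R → F) : {t : Finset (Fin R) // t.card = m} → F :=
  fun t => ∏ i ∈ t.1, d i

/-- Condition (Um) for the pair `(A, B)`. -/
def CondU {I J R : ℕ} (m : ℕ) (A : Matrix (Fin I) (Fin R) F)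
    (B : Matrix (Fin J) (Fin R) F) : Prop :=
  ∀ d : Fin R → F,
    (khatriRao (compound m A) (compound m B)).mulVec (hatVec m d) = 0 → hatVec m d = 0

/-- Condition (Wm) for the triple `(A, B, C)`. -/
def CondW {I J K R : ℕ} (m : ℕ) (A : Matrix (Fin I) (Fin R) F)
    (B : Matrix (Fin J) (Fin R) F) (C : Matrix (Fin K) (Fin R) F) : Prop :=
  ∀ d : Fin R → F, (∃ x : Fin K → F, d = C.transpose.mulVec x) →
    (khatriRao (compound m A) (compound m B)).mulVec (hatVec m d) = 0 → hatVec m d = 0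

/-- Condition (Hm) for the pair `(A, B)`: `H_{AB}(δ) ≥ min(δ, m)` for `δ = 1, …, R`. -/
def CondH {I J R : ℕ} (m : ℕ) (A : Matrix (Fin I) (Fin R) F)
    (B : Matrix (Fin J) (Fin R) F) : Prop :=
  ∀ δ : ℕ, 1 ≤ δ → δ ≤ R → ∀ s : Finset (Fin R), s.card = δ →
    δ + min δ m ≤ (A.submatrix id (fun x : {y // y ∈ s} => x.1)).rank +
      (B.submatrix id (fun x : {y // y ∈ s} => x.1)).rank


theorem cauchyBinet_aux {m R : ℕ} (M N : Matrix (Fin m) (Fin R) F) (d : Fin R → F) :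
    Matrix.det (Matrix.of fun i j : Fin m => ∑ r, M i r * d r * N j r) =
    ∑ t : {t : Finset (Fin R) // t.card = m},
      Matrix.det (Matrix.of fun i j : Fin m => M i (t.1.orderIsoOfFin t.2 j).1) *
      Matrix.det (Matrix.of fun i j : Fin m => N i (t.1.orderIsoOfFin t.2 j).1) *
      ∏ i ∈ t.1, d i := by
  classical
  have e1 : Matrix.det (Matrix.of fun i j : Fin m => ∑ r, M i r * d r * N j r) =
      ∑ p : Fin m → Fin R, (∏ i, (M i (p i) * d (p i))) *
        Matrix.det (Matrix.of fun i j : Fin m => N j (p i)) := by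
    have := (Matrix.detRowAlternating (n := Fin m) (R := F)).toMultilinearMap.map_sum
      (fun (i : Fin m) (r : Fin R) => (M i r * d r) • (fun j => N j r))
    have h2 : (fun i => ∑ r, (M i r * d r) • (fun j => N j r)) =
      (Matrix.of fun i j : Fin m => ∑ r, M i r * d r * N j r) := by
      ext i j; simp [Finset.sum_apply]
    rw [h2] at this
    refine this.trans (Finset.sum_congr rfl fun p _ => ?_)
    exact (Matrix.detRowAlternating (n := Fin m) (R := F)).toMultilinearMap.map_smul_univ _ _
  rw [e1]
  have e2 : ∀ t : {t : Finset (Fin R) // t.card = m},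
      Matrix.det (Matrix.of fun i j : Fin m => M i (t.1.orderIsoOfFin t.2 j).1) *
      Matrix.det (Matrix.of fun i j : Fin m => N i (t.1.orderIsoOfFin t.2 j).1) *
      ∏ i ∈ t.1, d i = ∑ σ : Equiv.Perm (Fin m),
        (∏ i, (M i (t.1.orderIsoOfFin t.2 (σ i)).1 * d (t.1.orderIsoOfFin t.2 (σ i)).1)) *
        Matrix.det (Matrix.of fun i j : Fin m => N j (t.1.orderIsoOfFin t.2 (σ i)).1) := by
    intro t
    have hd : ∀ σ : Equiv.Perm (Fin m), ∏ i, d (t.1.orderIsoOfFin t.2 (σ i)).1 = ∏ i ∈ t.1, d i := by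
      intro σ
      rw [Equiv.prod_comp σ (fun i => d (t.1.orderIsoOfFin t.2 i).1)]
      rw [← Finset.prod_coe_sort t.1]
      exact Equiv.prod_comp (t.1.orderIsoOfFin t.2).toEquiv (fun i : t.1 => d i.1)
    have hN : ∀ σ : Equiv.Perm (Fin m),
        Matrix.det (Matrix.of fun i j : Fin m => N j (t.1.orderIsoOfFin t.2 (σ i)).1) =
        (Equiv.Perm.sign σ : ℤ) * Matrix.det
          (Matrix.of fun i j : Fin m => N i (t.1.orderIsoOfFin t.2 j).1) := by
      intro σ
      rw [← Matrix.det_transpose (Matrix.of fun i j : Fin m => N i (t.1.orderIsoOfFin t.2 j).1)]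
      exact Matrix.det_permute σ
        (Matrix.of fun i j : Fin m => N i (t.1.orderIsoOfFin t.2 j).1).transpose
    simp only [Finset.prod_mul_distrib, hd, hN]
    rw [← Matrix.det_transpose (Matrix.of fun i j : Fin m => M i (t.1.orderIsoOfFin t.2 j).1)]
    rw [Matrix.det_apply', Finset.sum_mul, Finset.sum_mul]
    refine Finset.sum_congr rfl fun σ _ => ?_
    simp only [Matrix.transpose_apply, Matrix.of_apply]
    ring
  rw [Finset.sum_congr rfl fun t _ => e2 t, ← Finset.sum_product', Finset.univ_product_univ]
  symm
  refine Finset.sum_of_injOn (fun x : {t : Finset (Fin R) // t.card = m} × Equiv.Perm (Fin m) =>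
    fun i => (x.1.1.orderIsoOfFin x.1.2 (x.2 i)).1) ?_ ?_ ?_ ?_
  · rintro ⟨⟨t, ht⟩, σ⟩ _ ⟨⟨t', ht'⟩, σ'⟩ _ h
    simp only at h
    have hr : ∀ (t : Finset (Fin R)) (ht : t.card = m) (σ : Equiv.Perm (Fin m)),
        Finset.univ.image (fun i => (t.orderIsoOfFin ht (σ i)).1) = t := by
      intro t ht σ
      ext x
      simp only [Finset.mem_image, Finset.mem_univ, true_and]
      constructor
      · rintro ⟨i, rfl⟩; exact (t.orderIsoOfFin ht (σ i)).2
      · intro hx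
        exact ⟨σ.symm ((t.orderIsoOfFin ht).symm ⟨x, hx⟩), by simp⟩
    have htt : t = t' := by rw [← hr t ht σ, ← hr t' ht' σ', h]
    subst htt
    have : σ = σ' := by
      ext i
      have := congrFun h i
      have := (t.orderIsoOfFin ht).injective (Subtype.ext this)
      rw [this]
    rw [this]
  · intro x _; simp
  · intro p _ hp
    by_cases hinj : Function.Injective p
    · exfalso
      apply hp
      have hc : (Finset.univ.image p).card = m := by
        rw [Finset.card_image_of_injective _ hinj]; simp
      have hm : ∀ i, p i ∈ Finset.univ.image p := fun i => Finset.mem_image_of_mem _ (Finset.mem_univ _)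
      let f : Fin m → Fin m := fun i => ((Finset.univ.image p).orderIsoOfFin hc).symm ⟨p i, hm i⟩
      have hf : Function.Injective f := by
        intro i j hij
        have := ((Finset.univ.image p).orderIsoOfFin hc).symm.injective hij
        exact hinj (Subtype.mk.inj this)
      refine ⟨(⟨_, hc⟩, Equiv.ofBijective f (Finite.injective_iff_bijective.1 hf)), by simp, ?_⟩
      ext i
      simp [f]
    · simp only [Function.Injective] at hinj
      push Not at hinj
      obtain ⟨i, j, hij, hne⟩ := hinj
      rw [Matrix.det_zero_of_row_eq hne, mul_zero]
      ext k; simp [hij]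
  · intro x _; rfl

/-- Entries of the compound Khatri-Rao applied to hatVec are minors. -/
theorem compound_mulVec {I J R m : ℕ} (A : Matrix (Fin I) (Fin R) F) (B : Matrix (Fin J) (Fin R) F)
    (d : Fin R → F) (p) :
    (khatriRao (compound m A) (compound m B)).mulVec (hatVec m d) p =
    Matrix.det (Matrix.of fun i j : Fin m => ∑ r, A (p.1.1.orderIsoOfFin p.1.2 i).1 r * d r *
      B (p.2.1.orderIsoOfFin p.2.2 j).1 r) := by
  rw [cauchyBinet_aux (fun i r => A (p.1.1.orderIsoOfFin p.1.2 i).1 r)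
    (fun j r => B (p.2.1.orderIsoOfFin p.2.2 j).1 r)]
  rfl

open Classical in
theorem hatVec_eq_zero_iff {R m : ℕ} (d : Fin R → F) :
    hatVec m d = 0 ↔ (Finset.univ.filter (fun r => d r ≠ 0)).card < m := by
  constructor
  · intro h
    by_contra hc
    obtain ⟨t, ht, htc⟩ := Finset.exists_subset_card_eq (not_lt.1 hc)
    have := congrFun h ⟨t, htc⟩
    simp only [hatVec, Pi.zero_apply, Finset.prod_eq_zero_iff] at this
    obtain ⟨i, hi, hd⟩ := this
    exact (Finset.mem_filter.1 (ht hi)).2 hd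
  · intro h
    ext ⟨t, ht⟩
    simp only [hatVec, Pi.zero_apply, Finset.prod_eq_zero_iff]
    by_contra hc
    push Not at hc
    have := Finset.card_le_card (s := t) (t := Finset.univ.filter (fun r => d r ≠ 0))
      (fun i hi => by simp [hc i hi])
    omega

/-- Every linear functional on `F^K` is a dot product. -/
theorem dual_eq_dot {K : ℕ} (f : (Fin K → F) →ₗ[F] F) :
    ∃ x : Fin K → F, ∀ v, f v = ∑ k, v k * x k := by
  refine ⟨fun k => f (Pi.single k 1), fun v => ?_⟩
  conv_lhs => rw [← Finset.univ_sum_single v]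
  rw [map_sum]
  refine Finset.sum_congr rfl fun k _ => ?_
  have : (Pi.single k (v k) : Fin K → F) = v k • Pi.single k 1 := by
    ext j; by_cases h : j = k
    · subst h; simp
    · simp [h]
  rw [this, map_smul, smul_eq_mul]

theorem mem_cov_iff {K : ℕ} {V U : Submodule F (Fin K → F)} {w v : Fin K → F} (hw : w ∉ V)
    (hU : Submodule.span F {w} ⊔ V = U) (hv : v ∉ V) :
    v ∈ U ↔ Submodule.span F {v} ⊔ V = U := by
  constructor
  · intro h
    have hc : V ⋖ U := hU ▸ Submodule.covBy_span_singleton_sup hw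
    have h1 : V < Submodule.span F {v} ⊔ V := (Submodule.covBy_span_singleton_sup hv).lt
    have h2 : Submodule.span F {v} ⊔ V ≤ U :=
      sup_le ((Submodule.span_singleton_le_iff_mem _ _).2 h) hc.le
    rcases hc.eq_or_eq h1.le h2 with h3 | h3
    · exact absurd h3 h1.ne'
    · exact h3
  · intro h
    rw [← h]
    exact Submodule.mem_sup_left (Submodule.mem_span_singleton_self v)

open Classical in
/-- Kruskal's permutation lemma, flats version. -/
theorem flats_count {K R : ℕ} (c c' : Fin R → Fin K → F)
    (h : ∀ x : Fin K → F,
      Module.finrank F (Submodule.span F (Set.range c')) ≤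
        (Finset.univ.filter (fun r => ∑ k, c' r k * x k = 0)).card + 1 →
      (Finset.univ.filter (fun r => ∑ k, c' r k * x k = 0)).card ≤
        (Finset.univ.filter (fun r => ∑ k, c r k * x k = 0)).card)
    (V : Submodule F (Fin K → F)) (S : Finset (Fin R)) (hS : V = Submodule.span F (c' '' S)) :
    (Finset.univ.filter (fun r => c' r ∈ V)).card ≤
      (Finset.univ.filter (fun r => c r ∈ V)).card := by
  -- first, the columns of c lie in the span of the primed columns
  have hW : ∀ s, c s ∈ Submodule.span F (Set.range c') := by
    intro s
    by_contra hs
    obtain ⟨f, hf, hle⟩ := Submodule.exists_le_ker_of_notMem hs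
    obtain ⟨x, hx⟩ := dual_eq_dot f
    have hz : ∀ r, ∑ k, c' r k * x k = 0 := fun r => by
      rw [← hx]; exact hle (Submodule.subset_span ⟨r, rfl⟩)
    have h0 := h x (by
      simp only [hz, Finset.filter_true, Finset.card_univ, Fintype.card_fin]
      have := finrank_range_le_card (R := F) c'
      simp only [Set.finrank, Fintype.card_fin] at this
      omega)
    simp only [hz, Finset.filter_true] at h0
    have h1 : Finset.univ.filter (fun r => ∑ k, c r k * x k = 0) = Finset.univ :=
      Finset.eq_univ_of_card _ (le_antisymm (Finset.card_le_univ _) (by simpa using h0))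
    have h2 : s ∈ Finset.univ.filter (fun r => ∑ k, c r k * x k = 0) := by rw [h1]; simp
    rw [Finset.mem_filter, ← hx] at h2
    exact hf h2.2
  induction V using WellFoundedGT.induction generalizing S with
  | _ V ih =>
  set P : Finset (Submodule F (Fin K → F)) :=
    (Finset.univ.filter (fun r => c' r ∉ V)).image (fun r => Submodule.span F {c' r} ⊔ V) with hP
  have hPih : ∀ U ∈ P, (Finset.univ.filter (fun r => c' r ∈ U)).card ≤
      (Finset.univ.filter (fun r => c r ∈ U)).card := by
    intro U hU
    obtain ⟨r, hr, rfl⟩ := Finset.mem_image.1 hU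
    have hr' := (Finset.mem_filter.1 hr).2
    refine ih _ (Submodule.covBy_span_singleton_sup hr').lt (insert r S) ?_
    rw [Finset.coe_insert, Set.image_insert_eq, Submodule.span_insert, hS]
  have hVW : V ≤ Submodule.span F (Set.range c') := by
    rw [hS]; exact Submodule.span_mono (Set.image_subset_range _ _)
  -- counting
  have split : ∀ (g : Fin R → Fin K → F), ∀ U ∈ P,
      (Finset.univ.filter (fun r => g r ∈ U)).card = (Finset.univ.filter (fun r => g r ∈ V)).card +
      ((Finset.univ.filter (fun r => g r ∉ V)).filter
        (fun r => Submodule.span F {g r} ⊔ V = U)).card := by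
    intro g U hU
    obtain ⟨r0, hr0, hU0⟩ := Finset.mem_image.1 hU
    have hr0' := (Finset.mem_filter.1 hr0).2
    have hVU : V ≤ U := by rw [← hU0]; exact le_sup_right
    rw [← Finset.card_union_of_disjoint]
    · congr 1
      ext r
      simp only [Finset.mem_filter, Finset.mem_univ, true_and, Finset.mem_union]
      by_cases hr : g r ∈ V
      · simp [hr, hVU hr]
      · simp only [hr, false_or, not_false_eq_true, true_and]
        exact mem_cov_iff hr0' hU0 hr
    · rw [Finset.disjoint_left]
      intro r hr hr'
      simp only [Finset.mem_filter, Finset.mem_univ, true_and] at hr hr'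
      exact hr'.1 hr
  have tot : ∀ (g : Fin R → Fin K → F), (Finset.univ.filter (fun r => g r ∈ V)).card +
      (Finset.univ.filter (fun r => g r ∉ V)).card = R := by
    intro g
    have := Finset.card_filter_add_card_filter_not (s := (Finset.univ : Finset (Fin R)))
      (fun r => g r ∈ V)
    simpa using this
  have s1 : (Finset.univ.filter (fun r => c' r ∉ V)).card = ∑ U ∈ P,
      ((Finset.univ.filter (fun r => c' r ∉ V)).filter
        (fun r => Submodule.span F {c' r} ⊔ V = U)).card :=
    Finset.card_eq_sum_card_image _ _
  have s2 : ∑ U ∈ P, ((Finset.univ.filter (fun r => c r ∉ V)).filter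
        (fun r => Submodule.span F {c r} ⊔ V = U)).card ≤
      (Finset.univ.filter (fun r => c r ∉ V)).card := by
    rw [← Finset.card_biUnion]
    · apply Finset.card_le_card
      intro r hr
      obtain ⟨U, _, hU⟩ := Finset.mem_biUnion.1 hr
      exact (Finset.mem_filter.1 hU).1
    · intro U _ U' _ hne
      rw [Function.onFun, Finset.disjoint_left]
      intro r hr hr'
      exact hne ((Finset.mem_filter.1 hr).2.symm.trans (Finset.mem_filter.1 hr').2)
  have q1 : ∑ U ∈ P, (Finset.univ.filter (fun r => c' r ∈ U)).card =
      P.card * (Finset.univ.filter (fun r => c' r ∈ V)).card +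
        (Finset.univ.filter (fun r => c' r ∉ V)).card := by
    rw [Finset.sum_congr rfl (split c'), Finset.sum_add_distrib, ← s1]; simp
  have q2 : ∑ U ∈ P, (Finset.univ.filter (fun r => c r ∈ U)).card ≤
      P.card * (Finset.univ.filter (fun r => c r ∈ V)).card +
        (Finset.univ.filter (fun r => c r ∉ V)).card := by
    rw [Finset.sum_congr rfl (split c), Finset.sum_add_distrib]
    simpa using s2
  have q3 := Finset.sum_le_sum hPih
  have t1 := tot c
  have t2 := tot c'
  rcases Nat.lt_or_ge P.card 2 with hlt | hge
  · -- `V` is everything or a hyperplane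
    by_cases hall : ∀ r, c' r ∈ V
    · have hV : Submodule.span F (Set.range c') ≤ V := by
        rw [Submodule.span_le]; rintro _ ⟨r, rfl⟩; exact hall r
      have : ∀ r, c r ∈ V := fun r => hV (hW r)
      simp [this, hall]
    · push Not at hall
      obtain ⟨r0, hr0⟩ := hall
      have hmem0 : Submodule.span F {c' r0} ⊔ V ∈ P :=
        Finset.mem_image_of_mem _ (by simp [hr0])
      have hcov : V ⋖ Submodule.span F (Set.range c') := by
        have : Submodule.span F (Set.range c') = Submodule.span F {c' r0} ⊔ V := by
          apply le_antisymm
          · rw [Submodule.span_le]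
            rintro _ ⟨r, rfl⟩
            by_cases hr : c' r ∈ V
            · exact Submodule.mem_sup_right hr
            · have hmem : Submodule.span F {c' r} ⊔ V ∈ P :=
                Finset.mem_image_of_mem _ (by simp [hr])
              have := Finset.card_le_one.1 (Nat.lt_succ_iff.1 hlt) _ hmem _ hmem0
              rw [SetLike.mem_coe, ← this]
              exact Submodule.mem_sup_left (Submodule.mem_span_singleton_self _)
          · refine sup_le ((Submodule.span_singleton_le_iff_mem _ _).2
              (Submodule.subset_span ⟨r0, rfl⟩)) hVW
        rw [this]
        exact Submodule.covBy_span_singleton_sup hr0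
      obtain ⟨f, hf, hle⟩ := Submodule.exists_le_ker_of_notMem hr0
      obtain ⟨x, hx⟩ := dual_eq_dot f
      have hker : ∀ v ∈ Submodule.span F (Set.range c'), (∑ k, v k * x k = 0 ↔ v ∈ V) := by
        intro v hv
        rw [← hx]
        constructor
        · intro hv0
          by_contra hvV
          have hlt : V < LinearMap.ker f ⊓ Submodule.span F (Set.range c') :=
            lt_of_le_of_ne (le_inf hle hVW) (fun he => hvV (he ▸ ⟨hv0, hv⟩))
          rcases hcov.eq_or_eq hlt.le inf_le_right with h3 | h3
          · exact hlt.ne' h3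
          · have : c' r0 ∈ LinearMap.ker f ⊓ Submodule.span F (Set.range c') := by
              rw [h3]; exact Submodule.subset_span ⟨r0, rfl⟩
            exact hf this.1
        · intro hv0; exact hle hv0
      have k1 : ∀ r, (∑ k, c' r k * x k = 0 ↔ c' r ∈ V) :=
        fun r => hker _ (Submodule.subset_span ⟨r, rfl⟩)
      have k2 : ∀ r, (∑ k, c r k * x k = 0 ↔ c r ∈ V) := fun r => hker _ (hW r)
      have hh := h x
      simp only [k1, k2] at hh
      apply hh
      have hd : Submodule.span F (Set.range c') = Submodule.span F
          (((insert r0 (Finset.univ.filter (fun r => c' r ∈ V))).image c' : Finset _) :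
            Set (Fin K → F)) := by
        apply le_antisymm
        · have hz : Submodule.span F {c' r0} ⊔ V ≤ Submodule.span F
              (((insert r0 (Finset.univ.filter (fun r => c' r ∈ V))).image c' : Finset _) :
              Set (Fin K → F)) := by
            rw [Finset.image_insert, Finset.coe_insert, Submodule.span_insert]
            refine sup_le_sup_left ?_ _
            conv_lhs => rw [hS]
            apply Submodule.span_mono
            rintro _ ⟨r, hr, rfl⟩
            simp only [Finset.coe_image, Finset.coe_filter, Finset.mem_univ, true_and]
            refine ⟨r, ?_, rfl⟩
            show c' r ∈ V
            rw [hS]; exact Submodule.subset_span ⟨r, hr, rfl⟩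
          rw [Submodule.span_le]
          rintro _ ⟨r, rfl⟩
          apply hz
          by_cases hr : c' r ∈ V
          · exact Submodule.mem_sup_right hr
          · have hmem : Submodule.span F {c' r} ⊔ V ∈ P :=
              Finset.mem_image_of_mem _ (by simp [hr])
            have := Finset.card_le_one.1 (Nat.lt_succ_iff.1 hlt) _ hmem _ hmem0
            rw [← this]
            exact Submodule.mem_sup_left (Submodule.mem_span_singleton_self _)
        · apply Submodule.span_mono
          rw [Finset.coe_image]
          exact Set.image_subset_range _ _
      rw [hd]
      refine (finrank_span_finset_le_card _).trans ?_
      exact Finset.card_image_le.trans (Finset.card_insert_le _ _)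
  · by_contra hcon
    push Not at hcon
    obtain ⟨t, ht⟩ := Nat.exists_eq_add_of_le hge
    rw [ht] at q1 q2
    nlinarith

open Classical in
/-- Kruskal's permutation lemma. -/
theorem permutation_lemma {K R : ℕ} (c c' : Fin R → Fin K → F)
    (hc0 : ∀ r, c r ≠ 0)
    (hc2 : ∀ r s, r ≠ s → ∀ z : F, c r ≠ z • c s)
    (h : ∀ x : Fin K → F,
      Module.finrank F (Submodule.span F (Set.range c')) ≤
        (Finset.univ.filter (fun r => ∑ k, c' r k * x k = 0)).card + 1 →
      (Finset.univ.filter (fun r => ∑ k, c' r k * x k = 0)).card ≤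
        (Finset.univ.filter (fun r => ∑ k, c r k * x k = 0)).card) :
    ∃ σ : Equiv.Perm (Fin R), ∃ l : Fin R → F, (∀ r, l r ≠ 0) ∧ ∀ r, c' r = l r • c (σ r) := by
  have hne : ∀ r, c' r ≠ 0 := by
    intro r hr
    have := flats_count c c' h ⊥ ∅ (by simp)
    have h0 : (Finset.univ.filter (fun r => c r ∈ (⊥ : Submodule F (Fin K → F)))) = ∅ := by
      ext s; simp [hc0 s]
    rw [h0, Finset.card_empty, Nat.le_zero, Finset.card_eq_zero] at this
    have h1 : r ∈ (Finset.univ.filter (fun r => c' r ∈ (⊥ : Submodule F (Fin K → F)))) := by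
      simp [hr]
    rw [this] at h1
    simp at h1
  have hone : ∀ w : Fin K → F,
      (Finset.univ.filter (fun s => c s ∈ Submodule.span F {w})).card ≤ 1 := by
    intro w
    rw [Finset.card_le_one]
    intro s hs t ht
    by_contra hst
    simp only [Finset.mem_filter, Finset.mem_univ, true_and, Submodule.mem_span_singleton] at hs ht
    obtain ⟨a, ha⟩ := hs
    obtain ⟨b, hb⟩ := ht
    have hb0 : b ≠ 0 := by rintro rfl; exact hc0 t (by rw [← hb]; simp)
    apply hc2 s t hst (a * b⁻¹)
    rw [← ha, ← hb, smul_smul, mul_assoc, inv_mul_cancel₀ hb0, mul_one]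
  have hfl : ∀ r, (Finset.univ.filter (fun s => c' s ∈ Submodule.span F {c' r})).card ≤
      (Finset.univ.filter (fun s => c s ∈ Submodule.span F {c' r})).card := fun r =>
    flats_count c c' h _ {r} (by simp)
  have hself : ∀ r, r ∈ Finset.univ.filter (fun s => c' s ∈ Submodule.span F {c' r}) := fun r => by
    simp [Submodule.mem_span_singleton_self]
  have hex : ∀ r, ∃ s, c s ∈ Submodule.span F {c' r} := by
    intro r
    have : 0 < (Finset.univ.filter (fun s => c s ∈ Submodule.span F {c' r})).card :=
      lt_of_lt_of_le (Finset.card_pos.2 ⟨r, hself r⟩) (hfl r)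
    obtain ⟨s, hs⟩ := Finset.card_pos.1 this
    exact ⟨s, (Finset.mem_filter.1 hs).2⟩
  choose σ hσ using hex
  have hl : ∀ r, ∃ l : F, l ≠ 0 ∧ c' r = l • c (σ r) := by
    intro r
    obtain ⟨a, ha⟩ := Submodule.mem_span_singleton.1 (hσ r)
    have ha0 : a ≠ 0 := by rintro rfl; exact hc0 (σ r) (by rw [← ha]; simp)
    exact ⟨a⁻¹, inv_ne_zero ha0, by rw [← ha, smul_smul, inv_mul_cancel₀ ha0, one_smul]⟩
  choose l hl0 hl using hl
  have hinj : Function.Injective σ := by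
    intro r s hrs
    have h1 := (hfl r).trans (hone (c' r))
    refine Finset.card_le_one.1 h1 _ (hself r) _ ?_
    simp only [Finset.mem_filter, Finset.mem_univ, true_and]
    rw [hl s, ← hrs]
    exact Submodule.smul_mem _ _ (hσ r)
  exact ⟨Equiv.ofBijective σ (Finite.injective_iff_bijective.1 hinj), l, hl0, hl⟩

theorem krank_mem {I R : ℕ} (A : Matrix (Fin I) (Fin R) F) :
    krank A ≤ R ∧ ∀ s : Finset (Fin R), s.card = krank A →
    LinearIndependent F (fun r : {x // x ∈ s} => A.transpose r.1) := by
  refine Nat.sSup_mem (s := {k | k ≤ R ∧ ∀ s : Finset (Fin R), s.card = k →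
    LinearIndependent F (fun r : {x // x ∈ s} => A.transpose r.1)}) ⟨0, Nat.zero_le _, ?_⟩
    ⟨R, fun k hk => hk.1⟩
  intro s hs
  rw [Finset.card_eq_zero] at hs
  subst hs
  have : IsEmpty {x : Fin R // x ∈ (∅ : Finset (Fin R))} := ⟨fun x => Finset.notMem_empty _ x.2⟩
  exact linearIndependent_empty_type

theorem krank_indep {I R : ℕ} (A : Matrix (Fin I) (Fin R) F) (s : Finset (Fin R))
    (hs : s.card ≤ krank A) : LinearIndepOn F A.transpose (s : Set (Fin R)) := by
  obtain ⟨t, hst, ht⟩ := Finset.exists_superset_card_eq hs (by simpa using (krank_mem A).1)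
  have : LinearIndepOn F A.transpose (t : Set (Fin R)) := (krank_mem A).2 t ht
  exact this.mono (by exact_mod_cast hst)

theorem card_le_of_span_le {J R : ℕ} (b : Fin R → Fin J → F) (P : Finset (Fin R))
    (hP : LinearIndepOn F b (P : Set (Fin R))) (V : Submodule F (Fin J → F))
    (h : ∀ r ∈ P, b r ∈ V) : P.card ≤ Module.finrank F V := by
  have h1 := finrank_span_eq_card (R := F) (b := fun r : {x // x ∈ P} => b r.1) hP
  rw [Fintype.card_coe] at h1
  rw [← h1]
  apply Submodule.finrank_mono
  rw [Submodule.span_le]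
  rintro _ ⟨r, rfl⟩
  exact h r.1 r.2

theorem krank_le_rank {I R : ℕ} (A : Matrix (Fin I) (Fin R) F) : krank A ≤ A.rank := by
  obtain ⟨t, _, ht⟩ := Finset.exists_subset_card_eq
    (s := (Finset.univ : Finset (Fin R))) (n := krank A) (by simpa using (krank_mem A).1)
  rw [Matrix.rank_eq_finrank_span_cols, ← ht]
  exact card_le_of_span_le A.transpose t (krank_indep A t ht.le) _
    (fun r _ => Submodule.subset_span ⟨r, rfl⟩)

/-- Dual vectors to an independent family. -/
theorem exists_dual {I R : ℕ} (a : Fin R → Fin I → F) (P : Finset (Fin R))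
    (hP : LinearIndepOn F a (P : Set (Fin R))) (r : Fin R) (hr : r ∈ P) :
    ∃ y : Fin I → F, ∑ i, a r i * y i = 1 ∧ ∀ s ∈ P, s ≠ r → ∑ i, a s i * y i = 0 := by
  have h := hP.notMem_span (i := r) (by exact_mod_cast hr)
  obtain ⟨f, hf, hle⟩ := Submodule.exists_le_ker_of_notMem h
  obtain ⟨y, hy⟩ := dual_eq_dot ((f (a r))⁻¹ • f)
  refine ⟨y, ?_, ?_⟩
  · rw [← hy]; simp [hf]
  · intro s hs hne
    rw [← hy]
    have : f (a s) = 0 := hle (Submodule.subset_span ⟨s, ⟨by exact_mod_cast hs, hne⟩, rfl⟩)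
    simp [this]

/-- Contracting a matrix identity against `y` in the first mode. -/
theorem contract_first {I J R R' : ℕ} (A : Matrix (Fin I) (Fin R) F) (B : Matrix (Fin J) (Fin R) F)
    (A' : Matrix (Fin I) (Fin R') F) (B' : Matrix (Fin J) (Fin R') F) (d : Fin R → F)
    (d' : Fin R' → F)
    (h : ∀ i j, ∑ r, A i r * d r * B j r = ∑ r, A' i r * d' r * B' j r) (y : Fin I → F) (j : Fin J) :
    ∑ r, (∑ i, A i r * y i) * (d r * B j r) = ∑ r, (∑ i, A' i r * y i) * (d' r * B' j r) := by
  have key : ∀ (n : ℕ) (A : Matrix (Fin I) (Fin n) F) (B : Matrix (Fin J) (Fin n) F) (d : Fin n → F),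
      ∑ r, (∑ i, A i r * y i) * (d r * B j r) = ∑ i, y i * ∑ r, A i r * d r * B j r := by
    intro n A B d
    simp only [Finset.sum_mul, Finset.mul_sum]
    rw [Finset.sum_comm]
    refine Finset.sum_congr rfl fun i _ => Finset.sum_congr rfl fun r _ => ?_
    ring
  rw [key, key]
  simp only [h]

open Classical in
theorem mem_span_of_eq {I J R R' : ℕ} (A : Matrix (Fin I) (Fin R) F) (B : Matrix (Fin J) (Fin R) F)
    (A' : Matrix (Fin I) (Fin R') F) (B' : Matrix (Fin J) (Fin R') F) (d : Fin R → F)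
    (d' : Fin R' → F)
    (h : ∀ i j, ∑ r, A i r * d r * B j r = ∑ r, A' i r * d' r * B' j r)
    (P : Finset (Fin R)) (hdP : ∀ r, r ∈ P ↔ d r ≠ 0)
    (hA : LinearIndepOn F A.transpose (P : Set (Fin R))) (r : Fin R) (hr : r ∈ P) :
    B.transpose r ∈ Submodule.span F
      (((Finset.univ.filter (fun s => d' s ≠ 0)).image B'.transpose : Finset _) :
        Set (Fin J → F)) := by
  obtain ⟨y, hy1, hy0⟩ := exists_dual A.transpose P hA r hr
  simp only [Matrix.transpose_apply] at hy1 hy0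
  have hc := contract_first A B A' B' d d' h y
  have hL : ∀ j, ∑ s, (∑ i, A i s * y i) * (d s * B j s) = d r * B j r := by
    intro j
    rw [Finset.sum_eq_single r]
    · rw [hy1, one_mul]
    · intro s _ hs
      by_cases hsP : s ∈ P
      · rw [hy0 s hsP hs, zero_mul]
      · rw [hdP, not_not] at hsP
        rw [hsP, zero_mul, mul_zero]
    · simp
  have hb : B.transpose r =
      (d r)⁻¹ • ∑ s, ((∑ i, A' i s * y i) * d' s) • B'.transpose s := by
    ext j
    have := hc j
    rw [hL j] at this
    have hdr : d r ≠ 0 := (hdP r).1 hr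
    simp only [Matrix.transpose_apply, Pi.smul_apply, Finset.sum_apply, smul_eq_mul, mul_assoc]
    rw [← this, ← mul_assoc, inv_mul_cancel₀ hdr, one_mul]
  rw [hb]
  refine Submodule.smul_mem _ _ (Submodule.sum_mem _ fun s _ => ?_)
  by_cases hs : d' s = 0
  · simp [hs]
  · refine Submodule.smul_mem _ _ (Submodule.subset_span ?_)
    exact_mod_cast Finset.mem_image_of_mem _ (by simp [hs])

theorem pd_contract {I J K R R' : ℕ} {A : Matrix (Fin I) (Fin R) F} {B : Matrix (Fin J) (Fin R) F}
    {C : Matrix (Fin K) (Fin R) F} {A' : Matrix (Fin I) (Fin R') F} {B' : Matrix (Fin J) (Fin R') F}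
    {C' : Matrix (Fin K) (Fin R') F} (h : pdTensor A B C = pdTensor A' B' C') (x : Fin K → F)
    (i j) : ∑ r, A i r * (∑ k, C k r * x k) * B j r = ∑ r, A' i r * (∑ k, C' k r * x k) * B' j r := by
  have key : ∀ (n : ℕ) (A : Matrix (Fin I) (Fin n) F) (B : Matrix (Fin J) (Fin n) F)
      (C : Matrix (Fin K) (Fin n) F),
      ∑ r, A i r * (∑ k, C k r * x k) * B j r = ∑ k, pdTensor A B C i j k * x k := by
    intro n A B C
    simp only [pdTensor, Finset.sum_mul, Finset.mul_sum]
    rw [Finset.sum_comm]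
    refine Finset.sum_congr rfl fun k _ => Finset.sum_congr rfl fun r _ => ?_
    ring
  rw [key, key, h]

theorem span_le_of_pd {I J K R R' : ℕ} {A : Matrix (Fin I) (Fin R) F} {B : Matrix (Fin J) (Fin R) F}
    {C : Matrix (Fin K) (Fin R) F} {A' : Matrix (Fin I) (Fin R') F} {B' : Matrix (Fin J) (Fin R') F}
    {C' : Matrix (Fin K) (Fin R') F} (h : pdTensor A B C = pdTensor A' B' C')
    (h3 : FullColRank (khatriRao A B)) : C.rank ≤ C'.rank := by
  rw [Matrix.rank_eq_finrank_span_cols, Matrix.rank_eq_finrank_span_cols]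
  apply Submodule.finrank_mono
  rw [Submodule.span_le]
  rintro _ ⟨r, rfl⟩
  by_contra hr
  obtain ⟨f, hf, hle⟩ := Submodule.exists_le_ker_of_notMem hr
  obtain ⟨x, hx⟩ := dual_eq_dot f
  have hz : ∀ s, ∑ k, C' k s * x k = 0 := fun s => by
    have : f (C'.col s) = 0 := hle (Submodule.subset_span ⟨s, rfl⟩)
    rw [hx] at this
    exact this
  have hc := pd_contract h x
  simp only [hz, mul_zero, zero_mul, Finset.sum_const_zero] at hc
  have := Fintype.linearIndependent_iff.1 h3 (fun s => ∑ k, C k s * x k) (by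
    ext ⟨i, j⟩
    rw [Finset.sum_apply, Pi.zero_apply, ← hc i j]
    refine Finset.sum_congr rfl fun s _ => ?_
    simp only [Pi.smul_apply, Matrix.transpose_apply, khatriRao, smul_eq_mul]
    ring) r
  apply hf
  rw [hx]
  exact this

open Classical in
theorem third_unique {I J K R : ℕ} (A A' : Matrix (Fin I) (Fin R) F) (B B' : Matrix (Fin J) (Fin R) F)
    (C C' : Matrix (Fin K) (Fin R) F)
    (hkC : 2 ≤ krank C) (hkA : R - C.rank + 1 ≤ krank A) (hkB : R - C.rank + 1 ≤ krank B)
    (h2 : CondW (R - C.rank + 2) A B C) (h3 : FullColRank (khatriRao A B))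
    (h : pdTensor A B C = pdTensor A' B' C') :
    ∃ σ : Equiv.Perm (Fin R), ∃ l : Fin R → F, (∀ r, l r ≠ 0) ∧
      ∀ r, C'.transpose r = l r • C.transpose (σ r) := by
  refine permutation_lemma C.transpose C'.transpose ?_ ?_ ?_
  · intro r
    have := krank_indep C {r} (by simp; omega)
    exact this.ne_zero (by simp)
  · intro r s hrs z hz
    have := krank_indep C {r, s} (by rw [Finset.card_pair hrs]; exact hkC)
    apply this.notMem_span (i := r) (by simp)
    rw [hz]
    exact Submodule.smul_mem _ _ (Submodule.subset_span ⟨s, ⟨by simp, hrs.symm⟩, rfl⟩)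
  · intro x hx
    have hrk := span_le_of_pd h h3
    have hrk' : C'.rank = Module.finrank F (Submodule.span F (Set.range C'.transpose)) :=
      Matrix.rank_eq_finrank_span_cols C'
    rw [← hrk'] at hx
    simp only [Matrix.transpose_apply] at hx ⊢
    have hM := pd_contract h x
    set d : Fin R → F := fun r => ∑ k, C k r * x k with hd
    set d' : Fin R → F := fun r => ∑ k, C' k r * x k with hd'
    change C'.rank ≤ (Finset.univ.filter (fun r => d' r = 0)).card + 1 at hx
    change (Finset.univ.filter (fun r => d' r = 0)).card ≤
      (Finset.univ.filter (fun r => d r = 0)).card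
    change ∀ i j, ∑ r, A i r * d r * B j r = ∑ r, A' i r * d' r * B' j r at hM
    have n1 : (Finset.univ.filter (fun r => d r = 0)).card +
        (Finset.univ.filter (fun r => d r ≠ 0)).card = R := by
      simpa using Finset.card_filter_add_card_filter_not (s := (Finset.univ : Finset (Fin R)))
        (fun r => d r = 0)
    have n2 : (Finset.univ.filter (fun r => d' r = 0)).card +
        (Finset.univ.filter (fun r => d' r ≠ 0)).card = R := by
      simpa using Finset.card_filter_add_card_filter_not (s := (Finset.univ : Finset (Fin R)))
        (fun r => d' r = 0)
    have hw : hatVec (R - C.rank + 2) d = 0 := by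
      apply h2 d
      · refine ⟨x, ?_⟩
        ext r
        simp [hd, Matrix.mulVec, dotProduct]
      · ext p
        rw [compound_mulVec, Pi.zero_apply]
        simp only [hM]
        rw [← compound_mulVec A' B' d' p, (hatVec_eq_zero_iff d').2 (by omega), Matrix.mulVec_zero]
        rfl
    have hw' := (hatVec_eq_zero_iff d).1 hw
    have hA := krank_indep A (Finset.univ.filter (fun r => d r ≠ 0)) (by omega)
    have hB := krank_indep B (Finset.univ.filter (fun r => d r ≠ 0)) (by omega)
    have hmem := mem_span_of_eq A B A' B' d d' hM (Finset.univ.filter (fun r => d r ≠ 0))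
      (by simp) hA
    have hcard := card_le_of_span_le B.transpose _ hB _ hmem
    have := (hcard.trans (finrank_span_finset_le_card _)).trans Finset.card_image_le
    omega

open Classical in
theorem ab_unique {I J K R : ℕ} (A A' : Matrix (Fin I) (Fin R) F) (B B' : Matrix (Fin J) (Fin R) F)
    (C : Matrix (Fin K) (Fin R) F)
    (hkC : 2 ≤ krank C) (hkA : R + 1 ≤ krank A + krank C) (hkB : R + 2 ≤ krank B + krank C)
    (h : pdTensor A B C = pdTensor A' B' C) :
    ∃ β : Fin R → F, (∀ r, β r ≠ 0) ∧ (∀ i r, A i r = β r * A' i r) ∧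
      (∀ j r, B' j r = β r * B j r) := by
  have hCR := (krank_mem C).1
  obtain ⟨q, hq⟩ : ∃ q, q + krank C = R + 1 := ⟨R + 1 - krank C, by omega⟩
  -- the basic choice of `x`
  have hx : ∀ (r : Fin R) (S : Finset (Fin R)), r ∈ S → S.card = q →
      ∃ x : Fin K → F, ∑ k, C k r * x k = 1 ∧ ∀ s, s ∉ S → ∑ k, C k s * x k = 0 := by
    intro r S hr hS
    have hcard : (insert r Sᶜ).card = krank C := by
      rw [Finset.card_insert_of_notMem (by simpa using hr), Finset.card_compl, hS, Fintype.card_fin]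
      omega
    obtain ⟨x, hx1, hx0⟩ := exists_dual C.transpose (insert r Sᶜ) (krank_indep C _ hcard.le) r
      (by simp)
    refine ⟨x, hx1, fun s hs => hx0 s (by simp [hs]) ?_⟩
    rintro rfl; exact hs hr
  have hspan : ∀ (r : Fin R) (S : Finset (Fin R)), r ∈ S → S.card = q →
      B'.transpose r ∈ Submodule.span F (B.transpose '' (S : Set (Fin R))) := by
    intro r S hr hS
    obtain ⟨x, hx1, hx0⟩ := hx r S hr hS
    have hM := pd_contract h x
    set d : Fin R → F := fun r => ∑ k, C k r * x k with hd
    change ∀ i j, ∑ r, A i r * d r * B j r = ∑ r, A' i r * d r * B' j r at hM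
    set P := Finset.univ.filter (fun r => d r ≠ 0) with hP
    have hPS : P ⊆ S := by
      intro s hs
      by_contra hsS
      exact (Finset.mem_filter.1 hs).2 (hx0 s hsS)
    have hPc := Finset.card_le_card hPS
    have hA := krank_indep A P (by omega)
    have hB := krank_indep B P (by omega)
    have hmem := mem_span_of_eq A B A' B' d d hM P (by simp [hP]) hA
    have hle : Submodule.span F (B.transpose '' (P : Set (Fin R))) ≤ Submodule.span F
      ((P.image B'.transpose : Finset _) : Set (Fin J → F)) := by
      rw [Submodule.span_le]
      rintro _ ⟨s, hs, rfl⟩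
      exact hmem s (by exact_mod_cast hs)
    have hcard := card_le_of_span_le B.transpose P hB
      (Submodule.span F (B.transpose '' (P : Set (Fin R))))
      (fun s hs => Submodule.subset_span ⟨s, by exact_mod_cast hs, rfl⟩)
    have heq := Submodule.eq_of_le_of_finrank_le hle
      (((finrank_span_finset_le_card _).trans Finset.card_image_le).trans hcard)
    have : B'.transpose r ∈ Submodule.span F (B.transpose '' (P : Set (Fin R))) := by
      rw [heq]
      apply Submodule.subset_span
      have : r ∈ P := by
        rw [hP, Finset.mem_filter]
        refine ⟨Finset.mem_univ _, ?_⟩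
        rw [hd]; simp only [hx1]; exact one_ne_zero
      exact_mod_cast Finset.mem_image_of_mem _ this
    exact Submodule.span_mono (Set.image_mono (by exact_mod_cast hPS)) this
  have hSex : ∀ r : Fin R, ∃ S : Finset (Fin R), r ∈ S ∧ S.card = q := by
    intro r
    obtain ⟨S, hS, hc⟩ := Finset.exists_superset_card_eq (s := ({r} : Finset (Fin R))) (n := q)
      (by simp; omega) (by simp; omega)
    exact ⟨S, hS (by simp), hc⟩
  have hβ : ∀ r, ∃ β : F, B'.transpose r = β • B.transpose r := by
    intro r
    obtain ⟨S, hrS, hS⟩ := hSex r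
    obtain ⟨g, hg⟩ := Submodule.mem_span_image_finset_iff_exists_fun' F |>.1 (hspan r S hrS hS)
    refine ⟨g r, ?_⟩
    rw [← hg]
    refine Finset.sum_eq_single_of_mem r hrS fun s hs hsr => ?_
    obtain ⟨t, ht⟩ : ∃ t, t ∉ S := by
      by_contra hcon
      push Not at hcon
      have : S = Finset.univ := Finset.eq_univ_of_forall hcon
      rw [this, Finset.card_univ, Fintype.card_fin] at hS
      omega
    have hcS : (insert t (S.erase s)).card = q := by
      rw [Finset.card_insert_of_notMem (by simp [ht]), Finset.card_erase_of_mem hs]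
      have := Finset.card_pos.2 ⟨s, hs⟩
      omega
    have hin : (insert t S).card ≤ krank B := by
      rw [Finset.card_insert_of_notMem ht]; omega
    obtain ⟨y, hy1, hy0⟩ := exists_dual B.transpose (insert t S) (krank_indep B _ hin) s (by simp [hs])
    obtain ⟨g', hg'⟩ := Submodule.mem_span_image_finset_iff_exists_fun' F |>.1
      (hspan r _ (by simp [hrS, hsr.symm]) hcS)
    have ev : ∀ (g : Fin R → F) (Q : Finset (Fin R)),
        ∑ j, (∑ u ∈ Q, g u • B.transpose u) j * y j =
          ∑ u ∈ Q, g u * ∑ j, B.transpose u j * y j := by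
      intro g Q
      simp only [Finset.sum_apply, Pi.smul_apply, smul_eq_mul, Finset.sum_mul, Finset.mul_sum]
      rw [Finset.sum_comm]
      refine Finset.sum_congr rfl fun i _ => Finset.sum_congr rfl fun r _ => ?_
      ring
    have e1 := ev g S
    have e2 := ev g' (insert t (S.erase s))
    rw [hg] at e1
    rw [hg'] at e2
    rw [e1, Finset.sum_eq_single_of_mem s hs, hy1, mul_one] at e2
    · rw [e2, Finset.sum_eq_zero, zero_smul]
      intro u hu
      rw [hy0 u, mul_zero]
      · rw [Finset.mem_insert] at hu ⊢
        exact hu.imp id (fun h => Finset.mem_of_mem_erase h)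
      · rintro rfl
        rw [Finset.mem_insert] at hu
        rcases hu with rfl | hu
        · exact ht hs
        · simp at hu
    · intro u hu hus
      rw [hy0 u (by simp [hu]) hus, mul_zero]
  choose β hβ using hβ
  have hβ' : ∀ j r, B' j r = β r * B j r := fun j r => congrFun (hβ r) j
  have hA' : ∀ i r, A i r = β r * A' i r := by
    intro i r
    obtain ⟨S, hrS, hS⟩ := hSex r
    obtain ⟨x, hx1, hx0⟩ := hx r S hrS hS
    have hM := pd_contract h x
    obtain ⟨y, hy1, hy0⟩ := exists_dual B.transpose S (krank_indep B _ (by omega)) r hrS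
    simp only [Matrix.transpose_apply] at hy1 hy0
    have hM' : ∀ j i, ∑ r, B j r * (∑ k, C k r * x k) * A i r =
        ∑ r, B j r * (∑ k, C k r * x k) * (β r * A' i r) := by
      intro j i
      have := hM i j
      simp only [hβ'] at this
      calc _ = ∑ r, A i r * (∑ k, C k r * x k) * B j r :=
            Finset.sum_congr rfl fun _ _ => by ring
        _ = _ := this
        _ = _ := Finset.sum_congr rfl fun _ _ => by ring
    have hc := contract_first B A B (fun i r => β r * A' i r) _ _ hM' y i
    have red : ∀ g : Fin R → F,
        ∑ s, (∑ j, B j s * y j) * ((∑ k, C k s * x k) * g s) = g r := by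
      intro g
      rw [Finset.sum_eq_single r]
      · rw [hy1, hx1]; ring
      · intro s _ hs
        by_cases hsS : s ∈ S
        · rw [hy0 s hsS hs, zero_mul]
        · rw [hx0 s hsS]; ring
      · simp
    rw [red (fun s => A i s), red (fun s => β s * A' i s)] at hc
    exact hc
  refine ⟨β, fun r hr => ?_, hA', hβ'⟩
  have hne : A.transpose r ≠ 0 :=
    (krank_indep A {r} (by simp; omega)).ne_zero (by simp)
  apply hne
  ext i
  simp [hA' i r, hr]

theorem main_unique {I J K R : ℕ} (A A' : Matrix (Fin I) (Fin R) F) (B B' : Matrix (Fin J) (Fin R) F)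
    (C C' : Matrix (Fin K) (Fin R) F)
    (h1 : max (min (krank A) (krank B - 1)) (min (krank A - 1) (krank B)) + krank C ≥ R + 1)
    (h2 : CondW (R - C.rank + 2) A B C) (h3 : FullColRank (khatriRao A B))
    (h : pdTensor A B C = pdTensor A' B' C') :
    ∃ σ : Equiv.Perm (Fin R), ∃ la lb lc : Fin R → F,
      (∀ r, la r * lb r * lc r = 1) ∧
      (∀ i r, A' i r = A i (σ r) * la r) ∧
      (∀ j r, B' j r = B j (σ r) * lb r) ∧
      (∀ k r, C' k r = C k (σ r) * lc r) := by
  have hAR := (krank_mem A).1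
  have hBR := (krank_mem B).1
  have hCR := (krank_mem C).1
  have hCr := krank_le_rank C
  obtain ⟨σ, l, hl0, hl⟩ := third_unique A A' B B' C C' (by omega) (by omega) (by omega) h2 h3 h
  have hl' : ∀ k r, C' k r = l r * C k (σ r) := fun k r => congrFun (hl r) k
  have hT : pdTensor A B C = pdTensor (fun i s => A' i (σ.symm s))
      (fun j s => B' j (σ.symm s) * l (σ.symm s)) C := by
    rw [h]
    ext i j k
    simp only [pdTensor]
    refine Fintype.sum_equiv σ _ _ fun r => ?_
    rw [hl', Equiv.symm_apply_apply]
    ring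
  have key : ∃ β : Fin R → F, (∀ r, β r ≠ 0) ∧ (∀ i r, A i r = β r * A' i (σ.symm r)) ∧
      (∀ j r, B' j (σ.symm r) * l (σ.symm r) = β r * B j r) := by
    by_cases hcase : R + 1 ≤ krank A + krank C ∧ R + 2 ≤ krank B + krank C
    · exact ab_unique A _ B _ C (by omega) hcase.1 hcase.2 hT
    · have hT' : pdTensor B A C = pdTensor (fun j s => B' j (σ.symm s) * l (σ.symm s))
          (fun i s => A' i (σ.symm s)) C := by
        ext j i k
        have := congrFun (congrFun (congrFun hT i) j) k
        simp only [pdTensor] at this ⊢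
        calc _ = ∑ r, A i r * B j r * C k r := Finset.sum_congr rfl fun _ _ => by ring
          _ = _ := this
          _ = _ := Finset.sum_congr rfl fun _ _ => by ring
      obtain ⟨γ, hγ0, hγ1, hγ2⟩ := ab_unique B _ A _ C (by omega) (by omega) (by omega) hT'
      refine ⟨fun r => (γ r)⁻¹, fun r => inv_ne_zero (hγ0 r), fun i r => ?_, fun j r => ?_⟩
      · rw [hγ2, ← mul_assoc, inv_mul_cancel₀ (hγ0 r), one_mul]
      · rw [hγ1, ← mul_assoc, inv_mul_cancel₀ (hγ0 r), one_mul]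
  obtain ⟨β, hβ0, hβ1, hβ2⟩ := key
  refine ⟨σ, fun r => (β (σ r))⁻¹, fun r => β (σ r) * (l r)⁻¹, l, fun r => ?_, fun i r => ?_,
    fun j r => ?_, fun k r => ?_⟩
  · have := hβ0 (σ r)
    have := hl0 r
    field_simp
  · have := hβ0 (σ r)
    rw [hβ1 i (σ r), Equiv.symm_apply_apply]
    field_simp
  · have h' := hβ2 j (σ r)
    rw [Equiv.symm_apply_apply] at h'
    have := hl0 r
    rw [← mul_assoc, mul_comm (B j (σ r)), ← h', mul_assoc, mul_inv_cancel₀ this, mul_one]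
  · rw [hl' k r, mul_comm]

/-- Zero padding of a matrix to more columns. -/
def padCols {I R' : ℕ} (R : ℕ) (A : Matrix (Fin I) (Fin R') F) : Matrix (Fin I) (Fin R) F :=
  fun i r => if h : r.1 < R' then A i ⟨r.1, h⟩ else 0

theorem pdTensor_pad {I J K R R' : ℕ} (hR : R' ≤ R) (A : Matrix (Fin I) (Fin R') F)
    (B : Matrix (Fin J) (Fin R') F) (C : Matrix (Fin K) (Fin R') F) :
    pdTensor A B C = pdTensor (padCols R A) (padCols R B) (padCols R C) := by
  ext i j k
  simp only [pdTensor]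
  refine Finset.sum_of_injOn (Fin.castLE hR) (fun a _ b _ hab => Fin.castLE_injective hR hab)
    (fun _ _ => by simp) ?_ ?_
  · intro r _ hr
    have : ¬ r.1 < R' := fun hlt => hr ⟨⟨r.1, hlt⟩, by simp, rfl⟩
    simp [padCols, this]
  · intro r _
    simp [padCols]

/-- Proposition 1.13: uniqueness of the CPD under (5.1), (W m_C) and (C1). -/
theorem stmt_2 {I J K R : ℕ} (T : Fin I → Fin J → Fin K → F)
    (A : Matrix (Fin I) (Fin R) F) (B : Matrix (Fin J) (Fin R) F) (C : Matrix (Fin K) (Fin R) F)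
    (hPD : IsPD T A B C)
    (h1 : max (min (krank A) (krank B - 1)) (min (krank A - 1) (krank B)) + krank C ≥ R + 1)
    (h2 : CondW (R - C.rank + 2) A B C)
    (h3 : FullColRank (khatriRao A B)) :
    tensorRank T = R ∧ CPDUnique T R := by

  obtain ⟨hA0, hB0, hC0, hT⟩ := hPD
  constructor
  · apply le_antisymm
    · exact Nat.sInf_le ⟨A, B, C, hA0, hB0, hC0, hT⟩
    · refine le_csInf ⟨R, A, B, C, hA0, hB0, hC0, hT⟩ ?_
      rintro R' ⟨A', B', C', _, _, _, hT'⟩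
      by_contra hlt
      push Not at hlt
      obtain ⟨σ, la, lb, lc, hprod, _, _, hC⟩ := main_unique A (padCols R A') B (padCols R B') C
        (padCols R C') h1 h2 h3 (by rw [← hT, hT', ← pdTensor_pad hlt.le])
      apply hC0 (σ ⟨R', hlt⟩)
      ext k
      have h0 := hC k ⟨R', hlt⟩
      have hz : padCols R C' k ⟨R', hlt⟩ = 0 := by simp [padCols]
      rw [hz] at h0
      have hl : lc ⟨R', hlt⟩ ≠ 0 := by
        intro hl
        have := hprod ⟨R', hlt⟩
        rw [hl, mul_zero] at this
        exact zero_ne_one this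
      exact (mul_eq_zero.1 h0.symm).resolve_right hl
  · rintro A1 A2 B1 B2 C1 C2 ⟨_, _, _, hT1⟩ ⟨_, _, _, hT2⟩
    obtain ⟨σ1, la1, lb1, lc1, p1, a1, b1, c1⟩ :=
      main_unique A A1 B B1 C C1 h1 h2 h3 (hT.symm.trans hT1)
    obtain ⟨σ2, la2, lb2, lc2, p2, a2, b2, c2⟩ :=
      main_unique A A2 B B2 C C2 h1 h2 h3 (hT.symm.trans hT2)
    have hnz : ∀ r, la1 r ≠ 0 ∧ lb1 r ≠ 0 ∧ lc1 r ≠ 0 := by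
      intro r
      have := p1 r
      refine ⟨?_, ?_, ?_⟩ <;> intro hz <;> simp [hz] at this
    refine ⟨σ2.trans σ1.symm, fun r => la2 r / la1 (σ1.symm (σ2 r)),
      fun r => lb2 r / lb1 (σ1.symm (σ2 r)), fun r => lc2 r / lc1 (σ1.symm (σ2 r)), fun r => ?_,
      fun i r => ?_, fun i r => ?_, fun i r => ?_⟩
    · rw [div_mul_div_comm, div_mul_div_comm, p1, p2, div_one]
    · have := (hnz (σ1.symm (σ2 r))).1
      rw [Equiv.trans_apply, a1, a2, Equiv.apply_symm_apply]
      field_simp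
    · have := (hnz (σ1.symm (σ2 r))).2.1
      rw [Equiv.trans_apply, b1, b2, Equiv.apply_symm_apply]
      field_simp
    · have := (hnz (σ1.symm (σ2 r))).2.2
      rw [Equiv.trans_apply, c1, c2, Equiv.apply_symm_apply]
      field_simp
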